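/- arXiv:1309.5599 — 2 statements merged into one kernel-verified Lean document; each statement's English description precedes it below -/
import Mathlib

section
/- Let b ≥ 1 and let s_0, s_1, …, s_{b−1} : ℕ → ℚ each satisfy a linear homogeneous recurrence relation with constant rational coefficients (the recurrences need not be equal). Then the interlaced sequence t : ℕ → ℚ defined by t(b·n + i) = s_i(n) for 0 ≤ i ≤ b−1 also satisfies a linear homogeneous recurrence relation with constant rational coefficients. -/
/-- `s : ℕ → ℚ` satisfies a linear homogeneous recurrence relation with constant rational
coefficients: there exist `k ≥ 1` and `c_1, …, c_k ∈ ℚ` with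
`s n = ∑_{i=1}^k c_i * s (n - i)` for all `n ≥ k`. -/
def SatisfiesLinRec (s : ℕ → ℚ) : Prop :=
  ∃ k : ℕ, 1 ≤ k ∧ ∃ c : ℕ → ℚ, ∀ n, k ≤ n → s n = ∑ i ∈ Finset.Icc 1 k, c i * s (n - i)

open Polynomial

/-- The shift operator `(s n) ↦ (s (n + 1))` on rational sequences. -/
def seqShift : Module.End ℚ (ℕ → ℚ) where
  toFun s n := s (n + 1)
  map_add' _ _ := rfl
  map_smul' _ _ := rfl

theorem seqShift_pow_apply (k : ℕ) (s : ℕ → ℚ) (n : ℕ) : (seqShift ^ k) s n = s (n + k) := by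
  induction k generalizing n with
  | zero => rfl
  | succ k ih =>
    rw [pow_succ', Module.End.mul_apply]
    exact (ih (n + 1)).trans (by rw [add_right_comm, add_assoc])

theorem aeval_seqShift_monomial (k : ℕ) (a : ℚ) (s : ℕ → ℚ) (n : ℕ) :
    aeval seqShift (monomial k a) s n = a * s (n + k) := by
  rw [aeval_monomial, Module.End.mul_apply, Module.algebraMap_end_apply, Pi.smul_apply,
    seqShift_pow_apply, smul_eq_mul]

theorem aeval_seqShift_apply (p : ℚ[X]) (s : ℕ → ℚ) (n : ℕ) :
    aeval seqShift p s n = ∑ j ∈ Finset.range (p.natDegree + 1), p.coeff j * s (n + j) := by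
  conv_lhs => rw [p.as_sum_range]
  simp only [map_sum, LinearMap.sum_apply, Finset.sum_apply, aeval_seqShift_monomial]

theorem sum_Icc_one_eq_sum_range (k : ℕ) (f : ℕ → ℚ) :
    ∑ i ∈ Finset.Icc 1 k, f (k - i) = ∑ j ∈ Finset.range k, f j := by
  refine Finset.sum_nbij' (fun i => k - i) (fun j => k - j) ?_ ?_ ?_ ?_ (fun _ _ => rfl) <;>
    intro i hi <;> simp only [Finset.mem_Icc, Finset.mem_range] at hi ⊢ <;> omega

theorem SatisfiesLinRec.exists_monic_aeval_eq_zero {s : ℕ → ℚ} (h : SatisfiesLinRec s) :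
    ∃ p : ℚ[X], p.Monic ∧ aeval seqShift p s = 0 := by
  obtain ⟨k, -, c, hc⟩ := h
  refine ⟨X ^ k - ∑ i ∈ Finset.Icc 1 k, monomial (k - i) (c i), monic_X_pow_sub ?_, ?_⟩
  · rw [← mem_degreeLT]
    refine Submodule.sum_mem _ fun i hi => mem_degreeLT.2 ?_
    rw [Finset.mem_Icc] at hi
    exact (degree_monomial_le _ _).trans_lt (Nat.cast_lt.2 (by omega))
  · ext n
    simp only [map_sub, map_sum, map_pow, aeval_X, LinearMap.sub_apply, Pi.sub_apply,
      LinearMap.sum_apply, Finset.sum_apply, aeval_seqShift_monomial, seqShift_pow_apply,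
      Pi.zero_apply]
    rw [hc (n + k) (Nat.le_add_left k n), sub_eq_zero]
    refine Finset.sum_congr rfl fun i hi => ?_
    rw [Nat.add_sub_assoc (Finset.mem_Icc.1 hi).2]

theorem satisfiesLinRec_of_monic_aeval_eq_zero {s : ℕ → ℚ} {p : ℚ[X]} (hp : p.Monic)
    (hdeg : 1 ≤ p.natDegree) (h : aeval seqShift p s = 0) : SatisfiesLinRec s := by
  refine ⟨p.natDegree, hdeg, fun i => -p.coeff (p.natDegree - i), fun n hn => ?_⟩
  obtain ⟨m, rfl⟩ := Nat.exists_eq_add_of_le' hn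
  have hm := congrFun h m
  rw [aeval_seqShift_apply, Finset.sum_range_succ, hp.coeff_natDegree, one_mul, Pi.zero_apply,
    ← sum_Icc_one_eq_sum_range] at hm
  rw [eq_neg_of_add_eq_zero_right hm, ← Finset.sum_neg_distrib]
  refine Finset.sum_congr rfl fun i hi => ?_
  rw [Nat.add_sub_assoc (Finset.mem_Icc.1 hi).2, neg_mul]

theorem satisfiesLinRec_iff_exists_monic {s : ℕ → ℚ} :
    SatisfiesLinRec s ↔ ∃ p : ℚ[X], p.Monic ∧ aeval seqShift p s = 0 := by
  refine ⟨SatisfiesLinRec.exists_monic_aeval_eq_zero, fun ⟨p, hp, h⟩ => ?_⟩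
  refine satisfiesLinRec_of_monic_aeval_eq_zero (monic_X.mul hp) ?_ ?_
  · rw [natDegree_X_mul hp.ne_zero]
    exact Nat.le_add_left 1 _
  · rw [map_mul, Module.End.mul_apply, h, map_zero]

theorem aeval_seqShift_expand_apply {b i : ℕ} {s t : ℕ → ℚ} (ht : ∀ n, t (b * n + i) = s n)
    (p : ℚ[X]) (n : ℕ) :
    aeval seqShift (expand ℚ b p) t (b * n + i) = aeval seqShift p s n := by
  induction p using Polynomial.induction_on' with
  | add p q hp hq => simp only [map_add, LinearMap.add_apply, Pi.add_apply, hp, hq]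
  | monomial k a =>
    rw [expand_monomial, aeval_seqShift_monomial, aeval_seqShift_monomial, ← ht (n + k)]
    ring_nf

theorem stmt3 (b : ℕ) (hb : 1 ≤ b) (s : ℕ → ℕ → ℚ)
    (hs : ∀ i < b, SatisfiesLinRec (s i))
    (t : ℕ → ℚ) (ht : ∀ n : ℕ, ∀ i < b, t (b * n + i) = s i n) :
    SatisfiesLinRec t := by
  choose! p hp h using fun i hi => satisfiesLinRec_iff_exists_monic.1 (hs i hi)
  have hmonic : (∏ i ∈ Finset.range b, p i).Monic :=
    monic_prod_of_monic _ _ fun i hi => hp i (Finset.mem_range.1 hi)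
  refine satisfiesLinRec_iff_exists_monic.2 ⟨_, hmonic.expand hb, ?_⟩
  ext m
  have hi : m % b < b := Nat.mod_lt m hb
  obtain ⟨q, hq⟩ := Finset.dvd_prod_of_mem p (Finset.mem_range.2 hi)
  rw [← Nat.div_add_mod m b, aeval_seqShift_expand_apply (fun n => ht n _ hi), hq, mul_comm,
    map_mul, Module.End.mul_apply, h _ hi, map_zero]
  rfl
end

section
/- Let b ≥ 3 be an integer, let f(n) = max(1, n mod b), and let a be the associated f-sequence. For each n ≥ 1 let X_n be the number of summands in the unique f-decomposition of an integer chosen uniformly at random from {0, 1, …, a(bn) − 1}, and let μ_n, σ_n be the mean and standard deviation of X_n. Then the normalized random variables Y_n = (X_n − μ_n)/σ_n converge in distribution, as n → ∞, to the standard normal distribution N(0,1). -/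
open Finset

/-- The `f`-sequence associated to `f : ℕ → ℕ`. -/
def fSeq (f : ℕ → ℕ) : ℕ → ℕ
  | 0 => 1
  | n + 1 => fSeq f n + (if f n ≤ n then fSeq f (n - f n) else 1)
  decreasing_by all_goals omega

/-- A finite set of indices `S` is `f`-legal. -/
def FLegal (f : ℕ → ℕ) (S : Finset ℕ) : Prop :=
  ∀ i ∈ S, ∀ j ∈ S, j < i → f i < i - j

theorem fSeq_succ (f : ℕ → ℕ) (n : ℕ) : fSeq f (n + 1) = fSeq f n + fSeq f (n - f n) := by
  rw [fSeq]
  split_ifs with h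
  · rfl
  · rw [Nat.sub_eq_zero_of_le (by omega), fSeq]

theorem fSeq_mono (f : ℕ → ℕ) : Monotone (fSeq f) :=
  monotone_nat_of_le_succ fun n => by rw [fSeq_succ]; omega

theorem fSeq_pos (f : ℕ → ℕ) (n : ℕ) : 0 < fSeq f n := by
  have h := fSeq_mono f (Nat.zero_le n)
  rw [fSeq] at h
  omega

theorem FLegal.mono {f : ℕ → ℕ} {S T : Finset ℕ} (hT : FLegal f T) (h : S ⊆ T) : FLegal f S :=
  fun i hi j hj hji => hT i (h hi) j (h hj) hji

/-- Removing the top index `n` from a legal set leaves only indices below `n - f n`. -/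
theorem FLegal.erase_top_subset {f : ℕ → ℕ} {S : Finset ℕ} {n : ℕ} (hS : FLegal f S)
    (hsub : S ⊆ range (n + 1)) (hn : n ∈ S) : S.erase n ⊆ range (n - f n) := by
  intro j hj
  obtain ⟨hjn, hjS⟩ := mem_erase.1 hj
  have h1 := mem_range.1 (hsub hjS)
  have h2 := hS n hn j hjS (by omega)
  rw [mem_range]
  omega

theorem subset_range_of_notMem {S : Finset ℕ} {n : ℕ} (hsub : S ⊆ range (n + 1)) (hn : n ∉ S) :
    S ⊆ range n := by
  intro j hj
  have h1 := mem_range.1 (hsub hj)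
  have h2 : j ≠ n := fun h => hn (h ▸ hj)
  rw [mem_range]
  omega

theorem FLegal.sum_lt {f : ℕ → ℕ} (n : ℕ) {S : Finset ℕ} (hS : FLegal f S) (hsub : S ⊆ range n) :
    ∑ i ∈ S, fSeq f i < fSeq f n := by
  induction n using Nat.strong_induction_on generalizing S with
  | _ n ih =>
    cases n with
    | zero =>
      have : S = ∅ := by simpa using hsub
      simp [this, fSeq_pos]
    | succ n =>
      rw [fSeq_succ]
      by_cases hn : n ∈ S
      · have h := ih (n - f n) (by omega) (hS.mono (erase_subset n S)) (hS.erase_top_subset hsub hn)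
        rw [← add_sum_erase S (fSeq f) hn]
        omega
      · have h := ih n (by omega) hS (subset_range_of_notMem hsub hn)
        omega

theorem FLegal.eq_of_sum_eq_of_subset {f : ℕ → ℕ} (n : ℕ) {S T : Finset ℕ} (hS : FLegal f S)
    (hT : FLegal f T) (hSn : S ⊆ range n) (hTn : T ⊆ range n)
    (h : ∑ i ∈ S, fSeq f i = ∑ i ∈ T, fSeq f i) : S = T := by
  induction n generalizing S T with
  | zero =>
    have h1 : S = ∅ := by simpa using hSn
    have h2 : T = ∅ := by simpa using hTn
    rw [h1, h2]
  | succ n ih =>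
    by_cases hnS : n ∈ S <;> by_cases hnT : n ∈ T
    · have key := ih (hS.mono (erase_subset n S)) (hT.mono (erase_subset n T))
        ((hS.erase_top_subset hSn hnS).trans (range_mono (Nat.sub_le _ _)))
        ((hT.erase_top_subset hTn hnT).trans (range_mono (Nat.sub_le _ _)))
        (by
          rw [← add_sum_erase S (fSeq f) hnS, ← add_sum_erase T (fSeq f) hnT] at h
          omega)
      rw [← insert_erase hnS, ← insert_erase hnT, key]
    · have h1 := hT.sum_lt n (subset_range_of_notMem hTn hnT)
      rw [← add_sum_erase S (fSeq f) hnS] at h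
      omega
    · have h1 := hS.sum_lt n (subset_range_of_notMem hSn hnS)
      rw [← add_sum_erase T (fSeq f) hnT] at h
      omega
    · exact ih hS hT (subset_range_of_notMem hSn hnS) (subset_range_of_notMem hTn hnT) h

theorem subset_range_of_sum_lt {f : ℕ → ℕ} {n : ℕ} {S : Finset ℕ}
    (h : ∑ i ∈ S, fSeq f i < fSeq f n) : S ⊆ range n := by
  intro i hi
  rw [mem_range]
  by_contra hin
  have h1 := fSeq_mono f (not_lt.1 hin)
  have h2 : fSeq f i ≤ ∑ i ∈ S, fSeq f i := single_le_sum (fun _ _ => Nat.zero_le _) hi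
  omega

open Classical in
/-- The legal subsets of `{0, …, n - 1}`. -/
noncomputable def legalSets (f : ℕ → ℕ) (n : ℕ) : Finset (Finset ℕ) :=
  (range n).powerset.filter (FLegal f)

theorem mem_legalSets {f : ℕ → ℕ} {n : ℕ} {S : Finset ℕ} :
    S ∈ legalSets f n ↔ S ⊆ range n ∧ FLegal f S := by
  simp [legalSets]

/-- `Z m` is the number of summands in an `f`-decomposition of `m`, for all `m < fSeq f n`. -/
def IsSummandCount (f : ℕ → ℕ) (n : ℕ) (Z : ℕ → ℕ) : Prop :=
  ∀ m < fSeq f n, ∃ S : Finset ℕ, FLegal f S ∧ ∑ i ∈ S, fSeq f i = m ∧ S.card = Z m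

/-- Summing over integers below `fSeq f n` is summing over legal subsets of `{0, …, n - 1}`. -/
theorem IsSummandCount.sum_eq {M : Type*} [AddCommMonoid M] {f : ℕ → ℕ} {n : ℕ}
    {Z : ℕ → ℕ} (hZ : IsSummandCount f n Z) (φ : ℕ → M) :
    ∑ m ∈ range (fSeq f n), φ (Z m) = ∑ S ∈ legalSets f n, φ S.card := by
  symm
  refine sum_bij (fun S _ => ∑ i ∈ S, fSeq f i) ?_ ?_ ?_ ?_
  · intro S hS
    obtain ⟨h1, h2⟩ := mem_legalSets.1 hS
    exact mem_range.2 (h2.sum_lt n h1)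
  · intro S hS T hT h
    obtain ⟨hS1, hS2⟩ := mem_legalSets.1 hS
    obtain ⟨hT1, hT2⟩ := mem_legalSets.1 hT
    exact hS2.eq_of_sum_eq_of_subset n hT2 hS1 hT1 h
  · intro m hm
    obtain ⟨S, hS, hsum, -⟩ := hZ m (mem_range.1 hm)
    exact ⟨S, mem_legalSets.2 ⟨subset_range_of_sum_lt (hsum ▸ mem_range.1 hm), hS⟩, hsum⟩
  · intro S hS
    obtain ⟨hS1, hS2⟩ := mem_legalSets.1 hS
    have hlt := hS2.sum_lt n hS1
    obtain ⟨T, hT, hsum, hcard⟩ := hZ _ hlt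
    have hTS := hT.eq_of_sum_eq_of_subset n hS2 (subset_range_of_sum_lt (hsum ▸ hlt)) hS1 hsum
    rw [← hcard, hTS]

/-- The generating function of the cardinalities of legal subsets of `{0, …, n - 1}`. -/
noncomputable def legalGen {R : Type*} [CommRing R] (f : ℕ → ℕ) (x : R) (n : ℕ) : R :=
  ∑ S ∈ legalSets f n, x ^ S.card

section legalGen

variable {R : Type*} [CommRing R]

theorem legalGen_zero (f : ℕ → ℕ) (x : R) : legalGen f x 0 = 1 := by
  have : legalSets f 0 = {∅} := by
    ext S
    simp only [mem_legalSets, range_zero, subset_empty, mem_singleton, and_iff_left_iff_imp]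
    rintro rfl
    intro i hi
    simp at hi
  simp [legalGen, this]

theorem legalGen_succ (f : ℕ → ℕ) (x : R) (n : ℕ) :
    legalGen f x (n + 1) = legalGen f x n + x * legalGen f x (n - f n) := by
  classical
  have hnot : ∀ S ∈ legalSets f (n - f n), n ∉ S := fun S hS hn => by
    have := mem_range.1 ((mem_legalSets.1 hS).1 hn)
    omega
  have hset : legalSets f (n + 1) =
      legalSets f n ∪ (legalSets f (n - f n)).image (insert n) := by
    ext S
    simp only [mem_union, mem_image, mem_legalSets]
    constructor
    · rintro ⟨hsub, hS⟩
      by_cases hn : n ∈ S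
      · exact Or.inr ⟨S.erase n, ⟨hS.erase_top_subset hsub hn, hS.mono (erase_subset n S)⟩,
          insert_erase hn⟩
      · exact Or.inl ⟨subset_range_of_notMem hsub hn, hS⟩
    · rintro (⟨hsub, hS⟩ | ⟨T, ⟨hsub, hT⟩, rfl⟩)
      · exact ⟨hsub.trans (range_mono n.le_succ), hS⟩
      · refine ⟨?_, ?_⟩
        · intro j hj
          rw [mem_range]
          rcases mem_insert.1 hj with rfl | hj
          · omega
          · have := mem_range.1 (hsub hj)
            omega
        · intro i hi j hj hji
          rcases mem_insert.1 hi with rfl | hi' <;> rcases mem_insert.1 hj with rfl | hj'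
          · omega
          · have := mem_range.1 (hsub hj')
            omega
          · have := mem_range.1 (hsub hi')
            omega
          · exact hT i hi' j hj' hji
  have hdisj : Disjoint (legalSets f n) ((legalSets f (n - f n)).image (insert n)) := by
    rw [disjoint_left]
    intro S hS hS'
    obtain ⟨T, -, rfl⟩ := mem_image.1 hS'
    have := mem_range.1 ((mem_legalSets.1 hS).1 (mem_insert_self n T))
    omega
  have hinj : Set.InjOn (insert n) (legalSets f (n - f n) : Set (Finset ℕ)) := by
    intro S hS T hT h
    rw [← erase_insert (hnot S hS), ← erase_insert (hnot T hT), h]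
  rw [legalGen, hset, sum_union hdisj, sum_image hinj, legalGen, legalGen, mul_sum]
  congr 1
  refine sum_congr rfl fun S hS => ?_
  rw [card_insert_of_notMem (hnot S hS), pow_succ']

variable {b : ℕ}

theorem legalGen_block (x : R) (k r : ℕ) (hr : r + 1 ≤ b) :
    legalGen (fun n => max 1 (n % b)) x (b * k + (r + 1)) =
      (1 + r * x) * legalGen (fun n => max 1 (n % b)) x (b * k) +
        x * legalGen (fun n => max 1 (n % b)) x (b * k - 1) := by
  induction r with
  | zero => rw [zero_add, legalGen_succ]; simp
  | succ r ih =>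
    have hmod : (b * k + (r + 1)) % b = r + 1 := by
      rw [Nat.mul_add_mod, Nat.mod_eq_of_lt (by omega)]
    rw [← add_assoc (b * k), legalGen_succ, ih (by omega)]
    simp only [hmod]
    have : b * k + (r + 1) - max 1 (r + 1) = b * k := by
      rw [max_eq_right (by omega)]
      omega
    rw [this]
    push_cast
    ring

theorem legalGen_mul_succ (hb : 3 ≤ b) (x : R) (k : ℕ) :
    legalGen (fun n => max 1 (n % b)) x (b * (k + 1)) =
      (1 + (b - 1) * x) * legalGen (fun n => max 1 (n % b)) x (b * k) +
        x * legalGen (fun n => max 1 (n % b)) x (b * k - 1) := by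
  obtain ⟨c, rfl⟩ : ∃ c, b = c + 1 := ⟨b - 1, by omega⟩
  have h := legalGen_block (b := c + 1) x k c le_rfl
  rw [mul_add_one, h]
  push_cast
  ring

theorem legalGen_mul_succ_sub_one (hb : 3 ≤ b) (x : R) (k : ℕ) :
    legalGen (fun n => max 1 (n % b)) x (b * (k + 1) - 1) =
      (1 + (b - 2) * x) * legalGen (fun n => max 1 (n % b)) x (b * k) +
        x * legalGen (fun n => max 1 (n % b)) x (b * k - 1) := by
  obtain ⟨c, rfl⟩ : ∃ c, b = c + 2 := ⟨b - 2, by omega⟩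
  have h := legalGen_block (b := c + 2) x k c (by omega)
  have : (c + 2) * (k + 1) - 1 = (c + 2) * k + (c + 1) := by rw [mul_add_one]; omega
  rw [this, h]
  push_cast
  ring

theorem legalGen_mul_one (hb : 3 ≤ b) (x : R) :
    legalGen (fun n => max 1 (n % b)) x (b * 1) = 1 + b * x := by
  have h := legalGen_mul_succ hb x 0
  rw [mul_zero, Nat.zero_sub, legalGen_zero] at h
  rw [h]
  ring

theorem legalGen_mul_add_two (hb : 3 ≤ b) (x : R) (k : ℕ) :
    legalGen (fun n => max 1 (n % b)) x (b * (k + 2)) =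
      (1 + b * x) * legalGen (fun n => max 1 (n % b)) x (b * (k + 1)) -
        x ^ 2 * legalGen (fun n => max 1 (n % b)) x (b * k) := by
  have h1 := legalGen_mul_succ hb x (k + 1)
  rw [legalGen_mul_succ_sub_one hb x k] at h1
  rw [h1]
  linear_combination -x * legalGen_mul_succ hb x k

end legalGen

theorem Polynomial.Chebyshev.U_eq_C_mul_prod (n : ℕ) :
    Polynomial.Chebyshev.U ℝ n = Polynomial.C (2 ^ n) *
      ∏ j ∈ range n, (Polynomial.X - Polynomial.C (Real.cos ((j + 1) * Real.pi / (n + 1)))) := by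
  have hroots : (Polynomial.Chebyshev.U ℝ n).roots =
      (range n).val.map fun j : ℕ => Real.cos ((j + 1) * Real.pi / (n + 1)) := by
    rw [Polynomial.Chebyshev.roots_U_real, image_val]
    exact Multiset.dedup_eq_self.2 (Polynomial.Chebyshev.roots_U_real_nodup n)
  have hcard : (Polynomial.Chebyshev.U ℝ n).roots.card =
      (Polynomial.Chebyshev.U ℝ n).natDegree := by
    rw [hroots, Multiset.card_map, card_val, card_range,
      Polynomial.Chebyshev.natDegree_U_natCast]
  have h := Polynomial.C_leadingCoeff_mul_prod_multiset_X_sub_C hcard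
  rw [Polynomial.Chebyshev.leadingCoeff_U_natCast, hroots, Multiset.map_map] at h
  exact h.symm

/-- Second order recurrences of Chebyshev type have explicit product solutions. -/
theorem eq_prod_of_recurrence {D : ℕ → ℝ} {x z : ℝ} (h0 : D 0 = 1) (h1 : D 1 = z)
    (h2 : ∀ k, D (k + 2) = z * D (k + 1) - x ^ 2 * D k) (n : ℕ) :
    D n = ∏ j ∈ range n, (z - 2 * Real.cos ((j + 1) * Real.pi / (n + 1)) * x) := by
  by_cases hx : x = 0
  · subst hx
    simp only [mul_zero, sub_zero, prod_const, card_range]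
    induction n using Nat.twoStepInduction with
    | zero => simpa using h0
    | one => simpa using h1
    | more k _ ih => rw [h2, ih]; ring
  · have hU (k : ℕ) : D k = x ^ k * (Polynomial.Chebyshev.U ℝ k).eval (z / (2 * x)) := by
      induction k using Nat.twoStepInduction with
      | zero => simp [h0]
      | one => simp [h1]; field_simp
      | more k ih1 ih2 =>
        rw [h2, ih1, ih2]
        push_cast
        rw [Polynomial.Chebyshev.U_add_two]
        simp only [Polynomial.eval_sub, Polynomial.eval_mul, Polynomial.eval_ofNat,
          Polynomial.eval_X]
        field_simp
        ring
    rw [hU, Polynomial.Chebyshev.U_eq_C_mul_prod, Polynomial.eval_mul, Polynomial.eval_C,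
      Polynomial.eval_prod, ← mul_assoc, ← mul_pow]
    nth_rewrite 1 [← card_range n]
    rw [← prod_const, ← prod_mul_distrib]
    refine prod_congr rfl fun j _ => ?_
    simp only [Polynomial.eval_sub, Polynomial.eval_X, Polynomial.eval_C]
    field_simp

/-- The coefficients of the linear factors of the generating function of legal sets. -/
noncomputable def factorCoeff (b n j : ℕ) : ℝ :=
  b - 2 * Real.cos ((j + 1) * Real.pi / (n + 1))

theorem one_le_factorCoeff {b : ℕ} (hb : 3 ≤ b) (n j : ℕ) : 1 ≤ factorCoeff b n j := by
  have h := Real.cos_le_one ((j + 1) * Real.pi / (n + 1))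
  have hb' : (3 : ℝ) ≤ b := by exact_mod_cast hb
  rw [factorCoeff]
  linarith

theorem factorCoeff_le (b n j : ℕ) : factorCoeff b n j ≤ b + 2 := by
  have h := Real.neg_one_le_cos ((j + 1) * Real.pi / (n + 1))
  rw [factorCoeff]
  linarith

theorem sum_legalSets_X_pow_card {b : ℕ} (hb : 3 ≤ b) (n : ℕ) :
    ∑ S ∈ legalSets (fun n => max 1 (n % b)) (b * n), (Polynomial.X : Polynomial ℝ) ^ S.card =
      ∏ j ∈ range n, (1 + Polynomial.C (factorCoeff b n j) * Polynomial.X) := by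
  refine Polynomial.funext fun x => ?_
  have h := eq_prod_of_recurrence (D := fun k => legalGen (fun n => max 1 (n % b)) x (b * k))
    (x := x) (z := 1 + b * x) (by rw [mul_zero, legalGen_zero]) (legalGen_mul_one hb x)
    (legalGen_mul_add_two hb x) n
  simp only [Polynomial.eval_finsetSum, Polynomial.eval_prod, Polynomial.eval_pow,
    Polynomial.eval_X, Polynomial.eval_add, Polynomial.eval_one, Polynomial.eval_mul,
    Polynomial.eval_C]
  rw [← legalGen, h]
  refine prod_congr rfl fun j _ => ?_
  rw [factorCoeff]
  ring

/-- The success probabilities of the independent Bernoulli variables summing to `X_n`. -/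
noncomputable def factorProb (b n j : ℕ) : ℝ :=
  factorCoeff b n j / (1 + factorCoeff b n j)

theorem factorProb_nonneg {b : ℕ} (hb : 3 ≤ b) (n j : ℕ) : 0 ≤ factorProb b n j := by
  have := one_le_factorCoeff hb n j
  rw [factorProb]
  positivity

theorem one_sub_factorProb {b : ℕ} (hb : 3 ≤ b) (n j : ℕ) :
    1 - factorProb b n j = 1 / (1 + factorCoeff b n j) := by
  have := one_le_factorCoeff hb n j
  rw [factorProb]
  field_simp
  ring

theorem factorProb_le_one {b : ℕ} (hb : 3 ≤ b) (n j : ℕ) : factorProb b n j ≤ 1 := by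
  have := one_le_factorCoeff hb n j
  rw [← sub_nonneg, one_sub_factorProb hb]
  positivity

theorem le_factorProb_mul_one_sub {b : ℕ} (hb : 3 ≤ b) (n j : ℕ) :
    1 / 2 * (1 / (b + 3)) ≤ factorProb b n j * (1 - factorProb b n j) := by
  have h1 := one_le_factorCoeff hb n j
  have h2 := factorCoeff_le b n j
  refine mul_le_mul ?_ ?_ (by positivity) (factorProb_nonneg hb n j)
  · rw [factorProb, div_le_div_iff₀ (by norm_num) (by linarith)]
    linarith
  · rw [one_sub_factorProb hb]
    exact one_div_le_one_div_of_le (by linarith) (by linarith)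

open Polynomial in
theorem eval_one_derivatives_prod_bernoulli (s : Finset ℕ) (p : ℕ → ℝ) :
    eval 1 (∏ j ∈ s, (C (1 - p j) + C (p j) * X)) = 1 ∧
    eval 1 (derivative (∏ j ∈ s, (C (1 - p j) + C (p j) * X))) = ∑ j ∈ s, p j ∧
    eval 1 (derivative (derivative (∏ j ∈ s, (C (1 - p j) + C (p j) * X)))) =
      (∑ j ∈ s, p j) ^ 2 - ∑ j ∈ s, p j ^ 2 := by
  induction s using Finset.induction_on with
  | empty => simp
  | insert a s ha ih =>
    obtain ⟨h0, h1, h2⟩ := ih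
    rw [prod_insert ha, sum_insert ha, sum_insert ha]
    refine ⟨?_, ?_, ?_⟩
    · rw [eval_mul, h0]
      simp
    · rw [derivative_mul, eval_add, eval_mul, eval_mul, h0, h1]
      simp
    · simp only [derivative_mul, derivative_add, derivative_C, derivative_X, eval_add, eval_mul,
        h1, h2, eval_C, eval_X, zero_add, zero_mul, mul_one]
      ring

/-- The generating polynomial of the number of summands is that of a sum of independent
Bernoulli variables. -/
theorem sum_X_pow_eq_prod_bernoulli {b n : ℕ} {Z : ℕ → ℕ} (hb : 3 ≤ b)
    (hZ : IsSummandCount (fun n => max 1 (n % b)) (b * n) Z) :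
    ∑ m ∈ range (fSeq (fun n => max 1 (n % b)) (b * n)), (Polynomial.X : Polynomial ℝ) ^ Z m =
      Polynomial.C (fSeq (fun n => max 1 (n % b)) (b * n) : ℝ) * ∏ j ∈ range n,
        (Polynomial.C (1 - factorProb b n j) + Polynomial.C (factorProb b n j) * Polynomial.X) := by
  have h := hZ.sum_eq fun k => (Polynomial.X : Polynomial ℝ) ^ k
  rw [sum_legalSets_X_pow_card hb] at h
  have hcard : (fSeq (fun n => max 1 (n % b)) (b * n) : ℝ) =
      ∏ j ∈ range n, (1 + factorCoeff b n j) := by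
    simpa [Polynomial.eval_finsetSum, Polynomial.eval_prod] using congrArg (Polynomial.eval 1) h
  rw [h, hcard, map_prod, ← prod_mul_distrib]
  refine prod_congr rfl fun j _ => ?_
  have hne : 1 + factorCoeff b n j ≠ 0 := by linarith [one_le_factorCoeff hb n j]
  rw [mul_add, ← mul_assoc, ← Polynomial.C_mul, ← Polynomial.C_mul, one_sub_factorProb hb,
    mul_one_div_cancel hne, factorProb, mul_div_cancel₀ _ hne, Polynomial.C_1]

theorem sum_summands_eq {b n : ℕ} {Z : ℕ → ℕ} (hb : 3 ≤ b)
    (hZ : IsSummandCount (fun n => max 1 (n % b)) (b * n) Z) :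
    ∑ m ∈ range (fSeq (fun n => max 1 (n % b)) (b * n)), (Z m : ℝ) =
      fSeq (fun n => max 1 (n % b)) (b * n) * ∑ j ∈ range n, factorProb b n j := by
  have h := congrArg (fun P => Polynomial.eval 1 (Polynomial.derivative P))
    (sum_X_pow_eq_prod_bernoulli hb hZ)
  simp only [Polynomial.derivative_C_mul, Polynomial.eval_C_mul,
    (eval_one_derivatives_prod_bernoulli _ _).2.1] at h
  simpa [Polynomial.derivative_sum, Polynomial.eval_finsetSum,
    Polynomial.derivative_X_pow] using h

theorem sum_summands_descending_eq {b n : ℕ} {Z : ℕ → ℕ} (hb : 3 ≤ b)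
    (hZ : IsSummandCount (fun n => max 1 (n % b)) (b * n) Z) :
    ∑ m ∈ range (fSeq (fun n => max 1 (n % b)) (b * n)), (Z m : ℝ) * (Z m - 1) =
      fSeq (fun n => max 1 (n % b)) (b * n) *
        ((∑ j ∈ range n, factorProb b n j) ^ 2 - ∑ j ∈ range n, factorProb b n j ^ 2) := by
  have h := congrArg (fun P => Polynomial.eval 1 (Polynomial.derivative (Polynomial.derivative P)))
    (sum_X_pow_eq_prod_bernoulli hb hZ)
  simp only [Polynomial.derivative_C_mul, Polynomial.eval_C_mul,
    (eval_one_derivatives_prod_bernoulli _ _).2.2] at h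
  rw [← h]
  simp only [Polynomial.derivative_sum, Polynomial.eval_finsetSum, Polynomial.derivative_X_pow,
    Polynomial.derivative_C_mul, Polynomial.eval_C_mul, Polynomial.eval_pow, Polynomial.eval_X,
    one_pow, mul_one]
  refine sum_congr rfl fun m _ => ?_
  rcases Z m with _ | k <;> simp

theorem sum_sub_mean_sq_eq {b n : ℕ} {Z : ℕ → ℕ} (hb : 3 ≤ b)
    (hZ : IsSummandCount (fun n => max 1 (n % b)) (b * n) Z) :
    (∑ m ∈ range (fSeq (fun n => max 1 (n % b)) (b * n)),
        ((Z m : ℝ) - ∑ j ∈ range n, factorProb b n j) ^ 2) /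
        (fSeq (fun n => max 1 (n % b)) (b * n) : ℝ) =
      ∑ j ∈ range n, factorProb b n j * (1 - factorProb b n j) := by
  have hN : (fSeq (fun n => max 1 (n % b)) (b * n) : ℝ) ≠ 0 :=
    Nat.cast_ne_zero.2 (fSeq_pos _ _).ne'
  have h1 := sum_summands_eq hb hZ
  have h2 := sum_summands_descending_eq hb hZ
  set M := ∑ j ∈ range n, factorProb b n j with hM
  rw [div_eq_iff hN]
  have e (m : ℕ) : ((Z m : ℝ) - M) ^ 2 = Z m * (Z m - 1) + (1 - 2 * M) * Z m + M ^ 2 := by ring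
  have e' (j : ℕ) : factorProb b n j * (1 - factorProb b n j) =
      factorProb b n j - factorProb b n j ^ 2 := by ring
  simp only [e, e', sum_add_distrib, sum_sub_distrib, ← mul_sum, h1, h2, sum_const, card_range,
    nsmul_eq_mul, ← hM]
  ring

theorem sum_pow_summands_eq {b n : ℕ} {Z : ℕ → ℕ} (hb : 3 ≤ b)
    (hZ : IsSummandCount (fun n => max 1 (n % b)) (b * n) Z) (u : ℂ) :
    ∑ m ∈ range (fSeq (fun n => max 1 (n % b)) (b * n)), u ^ Z m =
      fSeq (fun n => max 1 (n % b)) (b * n) *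
        ∏ j ∈ range n, ((1 - factorProb b n j : ℝ) + factorProb b n j * u) := by
  have h := congrArg (Polynomial.aeval u) (sum_X_pow_eq_prod_bernoulli hb hZ)
  simpa [map_sum, map_prod] using h

/-- The characteristic function of a centred Bernoulli variable agrees with that of the Gaussian
of the same variance up to third order. -/
theorem norm_bernoulli_charFun_sub_le {p q s : ℝ} (hp : 0 ≤ p) (hq : 0 ≤ q) (hpq : p + q = 1)
    (hs : |s| ≤ 1) :
    ‖(q * Complex.exp (-(p * s : ℝ) * Complex.I) + p * Complex.exp ((q * s : ℝ) * Complex.I)) -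
      Complex.exp (-(p * q * s ^ 2 / 2 : ℝ))‖ ≤ 3 * |s| ^ 3 := by
  have hp1 : p ≤ 1 := by linarith
  have hq1 : q ≤ 1 := by linarith
  have third (z : ℂ) (hz : ‖z‖ ≤ |s|) : ‖Complex.exp z - (1 + z + z ^ 2 / 2)‖ ≤ |s| ^ 3 := by
    have h := Complex.exp_bound (hz.trans hs) (n := 3) (by norm_num)
    have e : ∑ m ∈ range 3, z ^ m / (m.factorial : ℂ) = 1 + z + z ^ 2 / 2 := by
      simp [sum_range_succ, Nat.factorial]
    rw [e] at h
    refine h.trans ?_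
    have h3 : ‖z‖ ^ 3 ≤ |s| ^ 3 := by gcongr
    have h0 : 0 ≤ ‖z‖ ^ 3 := by positivity
    norm_num [Nat.factorial]
    linarith
  have second (z : ℂ) (hz : ‖z‖ ≤ |s| ^ 2) : ‖Complex.exp z - (1 + z)‖ ≤ |s| ^ 3 := by
    have hs2 : |s| ^ 2 ≤ 1 := pow_le_one₀ (abs_nonneg s) hs
    have h := Complex.exp_bound (hz.trans hs2) (n := 2) (by norm_num)
    have e : ∑ m ∈ range 2, z ^ m / (m.factorial : ℂ) = 1 + z := by
      simp [sum_range_succ, Nat.factorial]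
    rw [e] at h
    refine h.trans ?_
    have h3 : ‖z‖ ^ 2 ≤ (|s| ^ 2) ^ 2 := by gcongr
    have h4 : (|s| ^ 2) ^ 2 ≤ |s| ^ 3 := by
      rw [← pow_mul]
      exact pow_le_pow_of_le_one (abs_nonneg s) hs (by norm_num)
    have h0 : 0 ≤ ‖z‖ ^ 2 := by positivity
    norm_num [Nat.factorial]
    linarith
  have habs (r : ℝ) (h0 : 0 ≤ r) (h1 : r ≤ 1) : |r * s| ≤ |s| := by
    rw [abs_mul, abs_of_nonneg h0]
    exact mul_le_of_le_one_left (abs_nonneg s) h1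
  have h1 := third (-(p * s : ℝ) * Complex.I) (by
    rw [norm_mul, norm_neg, Complex.norm_I, mul_one, Complex.norm_real]
    exact habs p hp hp1)
  have h2 := third ((q * s : ℝ) * Complex.I) (by
    rw [norm_mul, Complex.norm_I, mul_one, Complex.norm_real]
    exact habs q hq hq1)
  have h3 := second (-(p * q * s ^ 2 / 2 : ℝ)) (by
    rw [norm_neg, Complex.norm_real, Real.norm_eq_abs, abs_of_nonneg (by positivity), sq_abs]
    have : p * q ≤ 1 := mul_le_one₀ hp1 hq hq1
    nlinarith [sq_nonneg s])
  set z₁ : ℂ := -(p * s : ℝ) * Complex.I with hz₁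
  set z₂ : ℂ := (q * s : ℝ) * Complex.I with hz₂
  set z₃ : ℂ := -(p * q * s ^ 2 / 2 : ℝ) with hz₃
  have hqC : (q : ℂ) = 1 - p := by
    rw [← Complex.ofReal_one, ← Complex.ofReal_sub]
    congr 1
    linarith
  have key : (q * Complex.exp z₁ + p * Complex.exp z₂) - Complex.exp z₃ =
      q * (Complex.exp z₁ - (1 + z₁ + z₁ ^ 2 / 2)) + p * (Complex.exp z₂ - (1 + z₂ + z₂ ^ 2 / 2))
        - (Complex.exp z₃ - (1 + z₃)) := by
    have hI : Complex.I ^ 2 = -1 := Complex.I_sq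
    have : q * (1 + z₁ + z₁ ^ 2 / 2) + p * (1 + z₂ + z₂ ^ 2 / 2) = 1 + z₃ := by
      rw [hz₁, hz₂, hz₃]
      push_cast
      rw [hqC]
      linear_combination ((1 - p) * p ^ 2 * s ^ 2 / 2 + p * (1 - p) ^ 2 * s ^ 2 / 2 : ℂ) * hI
    linear_combination this
  rw [key]
  refine (norm_sub_le _ _).trans ?_
  refine (add_le_add_left (norm_add_le _ _) _).trans ?_
  rw [norm_mul, norm_mul, Complex.norm_real, Complex.norm_real, Real.norm_of_nonneg hp,
    Real.norm_of_nonneg hq]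
  have h4 := mul_le_mul_of_nonneg_left h1 hq
  have h5 := mul_le_mul_of_nonneg_left h2 hp
  have h6 : 0 ≤ |s| ^ 3 := by positivity
  nlinarith

theorem norm_prod_sub_prod_le_sum {ι : Type*} (s : Finset ι) (u v : ι → ℂ)
    (hu : ∀ i ∈ s, ‖u i‖ ≤ 1) (hv : ∀ i ∈ s, ‖v i‖ ≤ 1) :
    ‖∏ i ∈ s, u i - ∏ i ∈ s, v i‖ ≤ ∑ i ∈ s, ‖u i - v i‖ := by
  classical
  induction s using Finset.induction_on with
  | empty => simp
  | insert a s ha ih =>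
    have ih := ih (fun i hi => hu i (mem_insert_of_mem hi)) fun i hi => hv i (mem_insert_of_mem hi)
    rw [prod_insert ha, prod_insert ha, sum_insert ha]
    have e : u a * ∏ i ∈ s, u i - v a * ∏ i ∈ s, v i =
        (u a - v a) * ∏ i ∈ s, v i + u a * (∏ i ∈ s, u i - ∏ i ∈ s, v i) := by ring
    have hprod : ‖∏ i ∈ s, v i‖ ≤ 1 := by
      rw [norm_prod]
      exact prod_le_one (fun i _ => norm_nonneg _) fun i hi => hv i (mem_insert_of_mem hi)
    rw [e]
    refine (norm_add_le _ _).trans (add_le_add ?_ ?_)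
    · rw [norm_mul]
      exact mul_le_of_le_one_right (norm_nonneg _) hprod
    · rw [norm_mul]
      exact (mul_le_of_le_one_left (norm_nonneg _) (hu a (mem_insert_self a s))).trans ih

/-- Characteristic function form of the central limit theorem for sums of independent Bernoulli
variables with success probabilities `p n 0, …, p n (n - 1)`. -/
theorem tendsto_prod_bernoulli_charFun {p : ℕ → ℕ → ℝ} {δ : ℝ} (hδ : 0 < δ)
    (hp0 : ∀ n j, 0 ≤ p n j) (hp1 : ∀ n j, p n j ≤ 1)
    (hvar : ∀ n j, δ ≤ p n j * (1 - p n j)) {σ : ℕ → ℝ}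
    (hσ : ∀ n, σ n = √(∑ j ∈ range n, p n j * (1 - p n j))) (t : ℝ) :
    Filter.Tendsto (fun n => (∏ j ∈ range n,
        ((1 - p n j : ℝ) + p n j * Complex.exp ((t / σ n : ℝ) * Complex.I))) *
        Complex.exp (-(t * (∑ j ∈ range n, p n j) / σ n : ℝ) * Complex.I))
      Filter.atTop (nhds (Complex.exp (-(t ^ 2 / 2 : ℝ)))) := by
  have hsum (n : ℕ) : δ * n ≤ ∑ j ∈ range n, p n j * (1 - p n j) := by
    have := card_nsmul_le_sum (range n) (fun j => p n j * (1 - p n j)) δ fun j _ => hvar n j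
    rw [card_range, nsmul_eq_mul] at this
    linarith
  have hσsq (n : ℕ) : σ n ^ 2 = ∑ j ∈ range n, p n j * (1 - p n j) := by
    rw [hσ, Real.sq_sqrt]
    exact (by positivity : 0 ≤ δ * n).trans (hsum n)
  have hσtop : Filter.Tendsto σ Filter.atTop Filter.atTop := by
    rw [funext hσ]
    refine Real.tendsto_sqrt_atTop.comp (Filter.tendsto_atTop_mono hsum ?_)
    exact Filter.Tendsto.const_mul_atTop hδ tendsto_natCast_atTop_atTop
  rw [tendsto_iff_norm_sub_tendsto_zero]
  have hlim : Filter.Tendsto (fun n => 3 * |t| ^ 3 / δ * (σ n)⁻¹) Filter.atTop (nhds 0) := by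
    simpa using hσtop.inv_tendsto_atTop.const_mul (3 * |t| ^ 3 / δ)
  refine squeeze_zero' (Filter.Eventually.of_forall fun n => norm_nonneg _) ?_ hlim
  filter_upwards [hσtop.eventually_ge_atTop (max 1 |t|)] with n hn
  have hσ1 : 1 ≤ σ n := (le_max_left _ _).trans hn
  have hσpos : 0 < σ n := by linarith
  have hσne : σ n ≠ 0 := hσpos.ne'
  set s := t / σ n with hs
  have hs1 : |s| ≤ 1 := by
    rw [hs, abs_div, abs_of_pos hσpos, div_le_one hσpos]
    exact (le_max_right _ _).trans hn
  have e1 : (∏ j ∈ range n, ((1 - p n j : ℝ) + p n j * Complex.exp (s * Complex.I))) *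
        Complex.exp (-(t * (∑ j ∈ range n, p n j) / σ n : ℝ) * Complex.I) =
      ∏ j ∈ range n, ((1 - p n j : ℝ) * Complex.exp (-(p n j * s : ℝ) * Complex.I) +
        p n j * Complex.exp (((1 - p n j) * s : ℝ) * Complex.I)) := by
    have : -((t * (∑ j ∈ range n, p n j) / σ n : ℝ) : ℂ) * Complex.I =
        ∑ j ∈ range n, -(p n j * s : ℝ) * Complex.I := by
      rw [← sum_mul, sum_neg_distrib, ← Complex.ofReal_sum, ← sum_mul, hs]
      congr 3
      ring
    rw [this, Complex.exp_sum, ← prod_mul_distrib]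
    refine prod_congr rfl fun j _ => ?_
    rw [add_mul, mul_assoc, ← Complex.exp_add]
    congr 3
    push_cast
    ring
  have e2 : Complex.exp (-(t ^ 2 / 2 : ℝ)) =
      ∏ j ∈ range n, Complex.exp (-(p n j * (1 - p n j) * s ^ 2 / 2 : ℝ)) := by
    rw [← Complex.exp_sum, sum_neg_distrib, ← Complex.ofReal_sum, ← sum_div, ← sum_mul, ← hσsq, hs]
    congr 3
    field_simp
  rw [e1, e2]
  refine (norm_prod_sub_prod_le_sum _ _ _ ?_ ?_).trans ?_
  · intro j _
    refine (norm_add_le _ _).trans ?_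
    rw [norm_mul, norm_mul, ← Complex.ofReal_neg, Complex.norm_exp_ofReal_mul_I,
      Complex.norm_exp_ofReal_mul_I, Complex.norm_real, Complex.norm_real,
      Real.norm_of_nonneg (hp0 n j), Real.norm_of_nonneg (sub_nonneg.2 (hp1 n j))]
    linarith
  · intro j _
    rw [Complex.norm_exp, Complex.neg_re, Complex.ofReal_re, Real.exp_le_one_iff]
    have := hδ.le.trans (hvar n j)
    have : 0 ≤ p n j * (1 - p n j) * s ^ 2 / 2 := by positivity
    linarith
  · have h1 := sum_le_card_nsmul (range n)
      (fun j => ‖((1 - p n j : ℝ) * Complex.exp (-(p n j * s : ℝ) * Complex.I) +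
        p n j * Complex.exp (((1 - p n j) * s : ℝ) * Complex.I)) -
        Complex.exp (-(p n j * (1 - p n j) * s ^ 2 / 2 : ℝ))‖) (3 * |s| ^ 3)
      fun j _ => norm_bernoulli_charFun_sub_le (hp0 n j) (sub_nonneg.2 (hp1 n j)) (by ring) hs1
    refine h1.trans ?_
    rw [card_range, nsmul_eq_mul, hs, abs_div, abs_of_pos hσpos, div_pow]
    have h2 : (n : ℝ) ≤ σ n ^ 2 / δ := by
      rw [le_div_iff₀ hδ, hσsq]
      linarith [hsum n]
    calc (n : ℝ) * (3 * (|t| ^ 3 / σ n ^ 3)) ≤ σ n ^ 2 / δ * (3 * (|t| ^ 3 / σ n ^ 3)) := by gcongr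
      _ = 3 * |t| ^ 3 / δ * (σ n)⁻¹ := by field_simp

/-- The law of `Y` on a uniformly random element of `{0, …, N - 1}`. -/
noncomputable def uniformLaw {N : ℕ} (hN : 0 < N) (Y : ℕ → ℝ) :
    MeasureTheory.ProbabilityMeasure ℝ :=
  ⟨∑ m ∈ range N, (N : ENNReal)⁻¹ • MeasureTheory.Measure.dirac (Y m), ⟨by
    simp only [MeasureTheory.Measure.coe_finsetSum, Finset.sum_apply,
      MeasureTheory.Measure.smul_apply, MeasureTheory.measure_univ, smul_eq_mul, mul_one,
      sum_const, card_range, nsmul_eq_mul]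
    exact ENNReal.mul_inv_cancel (Nat.cast_ne_zero.2 hN.ne') (ENNReal.natCast_ne_top N)⟩⟩

theorem integral_uniformLaw {𝕜 : Type*} [RCLike 𝕜] {N : ℕ} (hN : 0 < N) (Y : ℕ → ℝ) (g : ℝ → 𝕜) :
    ∫ x, g x ∂(uniformLaw hN Y : MeasureTheory.Measure ℝ) = (∑ m ∈ range N, g (Y m)) / N := by
  rw [uniformLaw, MeasureTheory.ProbabilityMeasure.coe_mk,
    MeasureTheory.integral_finsetSum_measure]
  · simp [MeasureTheory.integral_smul_measure, ← mul_sum, div_eq_inv_mul,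
      RCLike.real_smul_eq_coe_mul]
  · intro m _
    refine MeasureTheory.Integrable.smul_measure ?_ (by simp [hN.ne'])
    exact MeasureTheory.integrable_dirac (by simp)

theorem stmt14 (b : ℕ) (hb : 3 ≤ b) (f : ℕ → ℕ) (hf : f = fun n => max 1 (n % b))
    -- `X n m` is the number of summands in the (unique) `f`-decomposition of `m`
    (X : ℕ → ℕ → ℕ)
    (hX : ∀ n : ℕ, ∀ m < fSeq f (b * n), ∃ S : Finset ℕ,
      FLegal f S ∧ ∑ i ∈ S, fSeq f i = m ∧ S.card = X n m)
    -- `μ n` is the mean of `X_n` under the uniform distribution on `{0, …, a(bn)−1}`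
    (μ : ℕ → ℝ)
    (hμ : ∀ n, μ n = (∑ m ∈ range (fSeq f (b * n)), (X n m : ℝ)) / (fSeq f (b * n) : ℝ))
    -- `σ n` is the standard deviation of `X_n`
    (σ : ℕ → ℝ)
    (hσ : ∀ n, σ n = Real.sqrt
      ((∑ m ∈ range (fSeq f (b * n)), ((X n m : ℝ) - μ n) ^ 2) / (fSeq f (b * n) : ℝ))) :
    -- `(X_n − μ_n)/σ_n` converges in distribution to the standard normal:
    -- expectations of bounded continuous test functions converge to the Gaussian integral
    ∀ g : BoundedContinuousFunction ℝ ℝ,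
      Filter.Tendsto
        (fun n => (∑ m ∈ range (fSeq f (b * n)),
            g (((X n m : ℝ) - μ n) / σ n)) / (fSeq f (b * n) : ℝ))
        Filter.atTop
        (nhds (∫ x, g x ∂(ProbabilityTheory.gaussianReal 0 1))) := by
  subst hf
  set N : ℕ → ℕ := fun n => fSeq (fun n => max 1 (n % b)) (b * n) with hN
  have hcount (n : ℕ) : IsSummandCount (fun n => max 1 (n % b)) (b * n) (X n) := hX n
  have hNpos (n : ℕ) : 0 < N n := fSeq_pos _ _
  have hNC (n : ℕ) : (N n : ℂ) ≠ 0 := Nat.cast_ne_zero.2 (hNpos n).ne'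
  have hμ' (n : ℕ) : μ n = ∑ j ∈ range n, factorProb b n j := by
    rw [hμ, sum_summands_eq hb (hcount n)]
    exact mul_div_cancel_left₀ _ (Nat.cast_ne_zero.2 (hNpos n).ne')
  have hσ' (n : ℕ) : σ n = √(∑ j ∈ range n, factorProb b n j * (1 - factorProb b n j)) := by
    rw [hσ, hμ', sum_sub_mean_sq_eq hb (hcount n)]
  have hlim := tendsto_prod_bernoulli_charFun (p := factorProb b) (δ := 1 / 2 * (1 / (b + 3)))
    (by positivity) (factorProb_nonneg hb) (factorProb_le_one hb) (le_factorProb_mul_one_sub hb) hσ'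
  let ν (n : ℕ) : MeasureTheory.ProbabilityMeasure ℝ :=
    uniformLaw (hNpos n) fun m => ((X n m : ℝ) - μ n) / σ n
  have hν : Filter.Tendsto ν Filter.atTop
      (nhds ⟨ProbabilityTheory.gaussianReal 0 1, inferInstance⟩) := by
    refine MeasureTheory.ProbabilityMeasure.tendsto_iff_tendsto_charFun.2 fun t => ?_
    have hgauss : MeasureTheory.charFun (ProbabilityTheory.gaussianReal 0 1) t =
        Complex.exp (-(t ^ 2 / 2 : ℝ)) := by
      rw [ProbabilityTheory.charFun_gaussianReal]
      congr 1
      push_cast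
      ring
    rw [MeasureTheory.ProbabilityMeasure.coe_mk, hgauss]
    refine (hlim t).congr fun n => ?_
    rw [MeasureTheory.charFun_apply_real, integral_uniformLaw, eq_div_iff (hNC n), mul_right_comm,
      mul_comm (∏ j ∈ range n, _), ← sum_pow_summands_eq hb (hcount n), sum_mul]
    refine sum_congr rfl fun m _ => ?_
    rw [← Complex.exp_nat_mul, ← Complex.exp_add, ← hμ']
    congr 1
    push_cast
    ring
  intro g
  refine ((MeasureTheory.ProbabilityMeasure.tendsto_iff_forall_integral_tendsto.1 hν g).congr
    fun n => ?_)
  exact integral_uniformLaw (hNpos n) _ g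
end
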